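/- Let X be a random vector in ℝ^d, let b ∈ ℝ^d, and let ν be a Lévy measure on ℝ^d satisfying ν(cB) = c^{−1} ν(B) for every c > 0 and every Borel set B ⊆ ℝ^d. Let σ be the spherical part of ν, i.e., the finite measure on the unit sphere S^{d−1} given by σ(A) = ν({u ∈ ℝ^d : ‖u‖ ≥ 1, u/‖u‖ ∈ A}), and assume ∫_{S^{d−1}} x σ(dx) = 0. Then the identity E[⟨X, ∇f(X)⟩] = ⟨b, E[∇f(X)]⟩ + E[∫_{ℝ^d} (f(X+u) − f(X) − ⟨∇f(X), u⟩ 1_{‖u‖≤1}) ν(du)] holds for every Schwartz function f ∈ S(ℝ^d) if and only if the characteristic function of X equals φ(ξ) = exp( i⟨b,ξ⟩ + ∫_{ℝ^d} (e^{i⟨ξ,u⟩} − 1 − i⟨ξ,u⟩ 1_{‖u‖≤1}) ν(du) ) for all ξ ∈ ℝ^d, i.e., X is a stable random vector with parameter b, stability index α = 1 and Lévy measure ν. -/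

import Mathlib

open MeasureTheory ProbabilityTheory Filter Set
open scoped RealInnerProductSpace ENNReal NNReal Topology Pointwise

noncomputable section

/-- A Lévy measure on `ℝ^d`. -/
def IsLevyMeasure {d : ℕ} (ν : Measure (EuclideanSpace ℝ (Fin d))) : Prop :=
  ν {0} = 0 ∧ ∫⁻ u, ENNReal.ofReal (min 1 (‖u‖ ^ 2)) ∂ν < ⊤

/-- The characteristic function of a measure on `ℝ^d`. -/
def charFn {d : ℕ} (μ : Measure (EuclideanSpace ℝ (Fin d)))
    (ξ : EuclideanSpace ℝ (Fin d)) : ℂ :=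
  ∫ x, Complex.exp (Complex.I * (⟪ξ, x⟫ : ℂ)) ∂μ

section LevyKernel

variable {d : ℕ}

/-- The integrand `e^{i⟨ξ,u⟩} - 1 - i⟨ξ,u⟩ 1_{‖u‖ ≤ 1}` of the Lévy–Khintchine formula. -/
def levyKernel (ξ u : EuclideanSpace ℝ (Fin d)) : ℂ :=
  Complex.exp (Complex.I * ((⟪ξ, u⟫ : ℝ) : ℂ)) - 1
    - (if ‖u‖ ≤ 1 then Complex.I * ((⟪ξ, u⟫ : ℝ) : ℂ) else 0)

/-- The Lévy–Khintchine exponent with drift `b` and Lévy measure `ν`. -/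
def levyExponent (ν : Measure (EuclideanSpace ℝ (Fin d))) (b ξ : EuclideanSpace ℝ (Fin d)) : ℂ :=
  Complex.I * ((⟪b, ξ⟫ : ℝ) : ℂ) + ∫ u, levyKernel ξ u ∂ν

lemma norm_exp_I_mul_ofReal (s : ℝ) : ‖Complex.exp (Complex.I * (s : ℂ))‖ = 1 := by
  rw [mul_comm]; exact Complex.norm_exp_ofReal_mul_I s

lemma norm_exp_I_mul_sub_one_sub_le (s : ℝ) :
    ‖Complex.exp (Complex.I * (s : ℂ)) - 1 - Complex.I * (s : ℂ)‖ ≤ 3 * s ^ 2 := by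
  have hs : ‖Complex.I * (s : ℂ)‖ = |s| := by simp
  rcases le_total |s| 1 with h | h
  · have := Complex.norm_exp_sub_one_sub_id_le (hs.trans_le h)
    rw [hs, sq_abs] at this
    nlinarith [sq_nonneg s]
  · calc _ ≤ ‖Complex.exp (Complex.I * (s : ℂ))‖ + ‖(1 : ℂ)‖ + ‖Complex.I * (s : ℂ)‖ :=
          (norm_sub_le _ _).trans (by gcongr; exact norm_sub_le _ _)
      _ = 2 + |s| := by rw [hs, norm_exp_I_mul_ofReal, norm_one]; ring
      _ ≤ 3 * s ^ 2 := by nlinarith [sq_abs s]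

lemma norm_levyKernel_le (ξ u : EuclideanSpace ℝ (Fin d)) :
    ‖levyKernel ξ u‖ ≤ 3 * (1 + ‖ξ‖ ^ 2) * min 1 (‖u‖ ^ 2) := by
  unfold levyKernel
  split_ifs with h
  · rw [min_eq_right (by nlinarith [norm_nonneg u])]
    refine (norm_exp_I_mul_sub_one_sub_le _).trans ?_
    have h1 : (⟪ξ, u⟫ : ℝ) ^ 2 ≤ (‖ξ‖ * ‖u‖) ^ 2 := sq_le_sq' (by
      linarith [neg_abs_le (⟪ξ, u⟫ : ℝ), abs_real_inner_le_norm ξ u]) (real_inner_le_norm ξ u)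
    nlinarith [sq_nonneg ‖u‖]
  · push Not at h
    rw [min_eq_left (by nlinarith), sub_zero]
    refine (norm_sub_le _ _).trans ?_
    rw [norm_exp_I_mul_ofReal, norm_one]
    nlinarith [sq_nonneg ‖ξ‖]

lemma measurable_levyKernel_comp {α : Type*} [MeasurableSpace α]
    {g h : α → EuclideanSpace ℝ (Fin d)} (hg : Measurable g) (hh : Measurable h) :
    Measurable fun a => levyKernel (g a) (h a) := by
  unfold levyKernel
  have h1 : Measurable fun a => Complex.I * ((⟪g a, h a⟫ : ℝ) : ℂ) := by fun_prop
  refine (h1.cexp.sub_const 1).sub (Measurable.ite ?_ h1 measurable_const)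
  exact measurableSet_le (by fun_prop) measurable_const

variable {ν : Measure (EuclideanSpace ℝ (Fin d))} {b : EuclideanSpace ℝ (Fin d)}

lemma IsLevyMeasure.integrable_min (hν : IsLevyMeasure ν) :
    Integrable (fun u => min 1 (‖u‖ ^ 2)) ν := by
  refine ⟨by fun_prop, ?_⟩
  rw [hasFiniteIntegral_iff_ofReal (Eventually.of_forall fun u => by positivity)]
  exact hν.2

lemma IsLevyMeasure.sigmaFinite (hν : IsLevyMeasure ν) : SigmaFinite ν := by
  set g : EuclideanSpace ℝ (Fin d) → ℝ≥0∞ := fun u => ENNReal.ofReal (min 1 (‖u‖ ^ 2)) with hg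
  have hgm : Measurable g := by fun_prop
  have : IsFiniteMeasure (ν.withDensity g) := isFiniteMeasure_withDensity hν.2.ne
  have hne : ∀ᵐ u ∂ν, g u ≠ 0 := by
    have : ∀ᵐ u ∂ν, u ≠ 0 := by
      rw [ae_iff]; simpa using hν.1
    filter_upwards [this] with u hu
    have : 0 < ‖u‖ := norm_pos_iff.2 hu
    simp only [hg, ne_eq, ENNReal.ofReal_eq_zero, not_le]
    positivity
  rw [← withDensity_inv_same₀ hgm.aemeasurable hne (by simp [hg])]
  refine SigmaFinite.withDensity_of_ne_top ?_
  filter_upwards [(withDensity_absolutelyContinuous ν g).ae_le hne] with u hu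
  simpa using hu

lemma integrable_levyKernel (hν : IsLevyMeasure ν) (ξ : EuclideanSpace ℝ (Fin d)) :
    Integrable (levyKernel ξ) ν :=
  (hν.integrable_min.const_mul (3 * (1 + ‖ξ‖ ^ 2))).mono'
    (measurable_levyKernel_comp measurable_const measurable_id).aestronglyMeasurable
    (Eventually.of_forall (norm_levyKernel_le ξ))

lemma continuous_levyExponent (hν : IsLevyMeasure ν) : Continuous (levyExponent ν b) := by
  refine Continuous.add (by fun_prop) ?_
  rw [continuous_iff_continuousAt]
  intro ξ₀
  refine continuousAt_of_dominated
    (bound := fun u => 3 * (1 + (‖ξ₀‖ + 1) ^ 2) * min 1 (‖u‖ ^ 2)) ?_ ?_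
    (hν.integrable_min.const_mul _) ?_
  · exact Eventually.of_forall fun ξ => (integrable_levyKernel hν ξ).aestronglyMeasurable
  · filter_upwards [Metric.ball_mem_nhds ξ₀ one_pos] with ξ hξ
    refine Eventually.of_forall fun u => (norm_levyKernel_le ξ u).trans ?_
    have : ‖ξ‖ ≤ ‖ξ₀‖ + 1 := by
      have := norm_le_norm_add_norm_sub' ξ ξ₀
      rw [mem_ball_iff_norm] at hξ
      linarith
    gcongr
  · refine Eventually.of_forall fun u => ?_
    unfold levyKernel
    split_ifs <;> fun_prop

lemma exists_norm_levyExponent_le (hν : IsLevyMeasure ν) :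
    ∃ C : ℝ, ∀ ξ, ‖levyExponent ν b ξ‖ ≤ C * (1 + ‖ξ‖ ^ 2) := by
  refine ⟨‖b‖ + 3 * ∫ u, min 1 (‖u‖ ^ 2) ∂ν, fun ξ => ?_⟩
  have h1 : ‖∫ u, levyKernel ξ u ∂ν‖ ≤ 3 * (1 + ‖ξ‖ ^ 2) * ∫ u, min 1 (‖u‖ ^ 2) ∂ν := by
    rw [← integral_const_mul]
    exact norm_integral_le_of_norm_le (hν.integrable_min.const_mul _)
      (Eventually.of_forall (norm_levyKernel_le ξ))
  have h2 : ‖Complex.I * ((⟪b, ξ⟫ : ℝ) : ℂ)‖ ≤ ‖b‖ * ‖ξ‖ := by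
    simpa using abs_real_inner_le_norm b ξ
  refine (norm_add_le _ _).trans ((add_le_add h2 h1).trans ?_)
  nlinarith [norm_nonneg b, norm_nonneg ξ, mul_nonneg (norm_nonneg b) (sq_nonneg (‖ξ‖ - 1)),
    mul_nonneg (norm_nonneg b) (sq_nonneg ‖ξ‖)]

end LevyKernel

section Scaling

variable {d : ℕ} {ν : Measure (EuclideanSpace ℝ (Fin d))} {b : EuclideanSpace ℝ (Fin d)}

lemma integral_comp_smul_of_scaling
    (hscal : ∀ c : ℝ, 0 < c → ∀ B : Set (EuclideanSpace ℝ (Fin d)), MeasurableSet B →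
      ν (c • B) = ENNReal.ofReal c⁻¹ * ν B)
    {F : Type*} [NormedAddCommGroup F] [NormedSpace ℝ F] {c : ℝ} (hc : 0 < c)
    (g : EuclideanSpace ℝ (Fin d) → F) :
    ∫ v, g (c • v) ∂ν = c • ∫ v, g v ∂ν := by
  have hmap : ν.map (fun v => c • v) = ENNReal.ofReal c • ν := by
    ext B hB
    rw [Measure.map_apply (by fun_prop) hB, preimage_smul₀ hc.ne', hscal _ (inv_pos.2 hc) _ hB]
    simp
  have hemb : MeasurableEmbedding (fun v : EuclideanSpace ℝ (Fin d) => c • v) :=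
    (Homeomorph.smulOfNeZero c hc.ne').measurableEmbedding
  rw [← hemb.integral_map, hmap, integral_smul_measure, ENNReal.toReal_ofReal hc.le]

lemma IsLevyMeasure.measure_lt_norm_lt_top (hν : IsLevyMeasure ν) {r : ℝ} (hr : 0 < r) :
    ν {v | r < ‖v‖} < ⊤ := by
  refine (measure_mono ?_).trans_lt
    (hν.integrable_min.measure_ge_lt_top (ε := min 1 (r ^ 2)) (by positivity))
  intro v (hv : r < ‖v‖)
  exact min_le_min le_rfl (pow_le_pow_left₀ hr.le hv.le 2)

lemma measure_norm_eq_zero (hν : IsLevyMeasure ν)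
    (hscal : ∀ c : ℝ, 0 < c → ∀ B : Set (EuclideanSpace ℝ (Fin d)), MeasurableSet B →
      ν (c • B) = ENNReal.ofReal c⁻¹ * ν B) :
    ν {v | ‖v‖ = 1} = 0 := by
  have := hν.sigmaFinite
  by_contra h
  have hc : Set.Countable {t : ℝ | 0 < ν {v | ‖v‖ = t}} :=
    Measure.countable_meas_level_set_pos measurable_norm
  refine Set.Countable.mono (s₁ := Ioi (0 : ℝ)) ?_ hc |>.measure_zero volume |>.symm.not_lt ?_
  · intro c (hc : 0 < c)
    have hset : {v : EuclideanSpace ℝ (Fin d) | ‖v‖ = c} = c • {v | ‖v‖ = 1} := by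
      ext v
      rw [mem_smul_set_iff_inv_smul_mem₀ hc.ne', mem_ofPred_eq, mem_ofPred_eq, norm_smul, norm_inv,
        Real.norm_of_nonneg hc.le, inv_mul_eq_one₀ hc.ne', eq_comm]
    rw [mem_ofPred_eq, hset, hscal c hc _ (measurableSet_eq_fun (by fun_prop) (by fun_prop))]
    exact ENNReal.mul_pos (by simpa using hc) h
  · simp

lemma norm_inv_norm_smul_le {F : Type*} [NormedAddCommGroup F] [NormedSpace ℝ F] (v : F) :
    ‖‖v‖⁻¹ • v‖ ≤ 1 := by
  rw [norm_smul, norm_inv, norm_norm]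
  exact inv_mul_le_one

lemma integrableOn_inv_norm_smul (hν : IsLevyMeasure ν) {r : ℝ} (hr : 0 < r) :
    IntegrableOn (fun v => ‖v‖⁻¹ • v) {v | r < ‖v‖} ν :=
  Measure.integrableOn_of_bounded (hν.measure_lt_norm_lt_top hr).ne
    (by fun_prop) (Eventually.of_forall norm_inv_norm_smul_le)

lemma setIntegral_lt_norm_eq_zero (hν : IsLevyMeasure ν)
    (hscal : ∀ c : ℝ, 0 < c → ∀ B : Set (EuclideanSpace ℝ (Fin d)), MeasurableSet B →
      ν (c • B) = ENNReal.ofReal c⁻¹ * ν B)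
    (hsym : (∫ u in {u : EuclideanSpace ℝ (Fin d) | 1 ≤ ‖u‖}, ‖u‖⁻¹ • u ∂ν) = 0)
    {r : ℝ} (hr : 0 < r) : ∫ v in {v | r < ‖v‖}, ‖v‖⁻¹ • v ∂ν = 0 := by
  have hm : ∀ r : ℝ, MeasurableSet {v : EuclideanSpace ℝ (Fin d) | r < ‖v‖} := fun r =>
    measurableSet_lt measurable_const measurable_norm
  have h1 : ∫ v in {v | 1 < ‖v‖}, ‖v‖⁻¹ • v ∂ν = 0 := by
    rw [← hsym]
    refine setIntegral_congr_set ?_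
    have h0 : ∀ᵐ v ∂ν, ‖v‖ ≠ 1 := by
      rw [ae_iff]; simpa using measure_norm_eq_zero hν hscal
    filter_upwards [h0] with v hv
    exact propext ⟨fun h => le_of_lt h, fun h => lt_of_le_of_ne h hv.symm⟩
  rw [← integral_indicator (hm _)] at h1 ⊢
  have := integral_comp_smul_of_scaling hscal hr
    ({v | r < ‖v‖}.indicator fun v : EuclideanSpace ℝ (Fin d) => ‖v‖⁻¹ • v)
  have heq : ∀ v : EuclideanSpace ℝ (Fin d),
      {v | r < ‖v‖}.indicator (fun v : EuclideanSpace ℝ (Fin d) => ‖v‖⁻¹ • v) (r • v)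
        = {v | 1 < ‖v‖}.indicator (fun v : EuclideanSpace ℝ (Fin d) => ‖v‖⁻¹ • v) v := by
    intro v
    have hn : ‖r • v‖ = r * ‖v‖ := by rw [norm_smul, Real.norm_of_nonneg hr.le]
    simp only [indicator, mem_ofPred_eq, hn, lt_mul_iff_one_lt_right hr]
    congr 1
    rw [smul_smul, mul_inv, mul_right_comm, inv_mul_cancel₀ hr.ne', one_mul]
  simp_rw [heq, h1] at this
  exact (smul_eq_zero_iff_right hr.ne').1 this.symm

lemma setIntegral_annulus_direction_eq_zero (hν : IsLevyMeasure ν)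
    (hscal : ∀ c : ℝ, 0 < c → ∀ B : Set (EuclideanSpace ℝ (Fin d)), MeasurableSet B →
      ν (c • B) = ENNReal.ofReal c⁻¹ * ν B)
    (hsym : (∫ u in {u : EuclideanSpace ℝ (Fin d) | 1 ≤ ‖u‖}, ‖u‖⁻¹ • u ∂ν) = 0)
    {r s : ℝ} (hr : 0 < r) (hrs : r ≤ s) :
    ∫ v in {v | r < ‖v‖ ∧ ‖v‖ ≤ s}, ‖v‖⁻¹ • v ∂ν = 0 := by
  have hset : {v : EuclideanSpace ℝ (Fin d) | r < ‖v‖ ∧ ‖v‖ ≤ s}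
      = {v | r < ‖v‖} \ {v | s < ‖v‖} := by
    ext v; simp
  rw [hset, setIntegral_sdiff (measurableSet_lt measurable_const measurable_norm)
    (integrableOn_inv_norm_smul hν hr) (fun v hv => lt_of_le_of_lt hrs hv),
    setIntegral_lt_norm_eq_zero hν hscal hsym hr,
    setIntegral_lt_norm_eq_zero hν hscal hsym (hr.trans_le hrs), sub_zero]

lemma setIntegral_annulus_eq_zero (hν : IsLevyMeasure ν)
    (hscal : ∀ c : ℝ, 0 < c → ∀ B : Set (EuclideanSpace ℝ (Fin d)), MeasurableSet B →
      ν (c • B) = ENNReal.ofReal c⁻¹ * ν B)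
    (hsym : (∫ u in {u : EuclideanSpace ℝ (Fin d) | 1 ≤ ‖u‖}, ‖u‖⁻¹ • u ∂ν) = 0)
    {r s : ℝ} (hr : 0 < r) (hrs : r ≤ s) :
    ∫ v in {v | r < ‖v‖ ∧ ‖v‖ ≤ s}, v ∂ν = 0 := by
  have := hν.sigmaFinite
  set A := {v : EuclideanSpace ℝ (Fin d) | r < ‖v‖ ∧ ‖v‖ ≤ s} with hA
  have hAm : MeasurableSet A := (measurableSet_lt measurable_const measurable_norm).inter
    (measurableSet_le measurable_norm measurable_const)
  have hfin : IsFiniteMeasure (ν.restrict A) := by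
    refine isFiniteMeasure_restrict.2 (ne_top_of_le_ne_top (hν.measure_lt_norm_lt_top hr).ne
      (measure_mono fun v hv => hv.1))
  have hint : ∀ t : ℝ, Integrable (fun v => t • ‖v‖⁻¹ • v) (ν.restrict A) := fun t =>
    Integrable.smul t ((integrableOn_inv_norm_smul hν hr).mono_set fun v hv => hv.1)
  have hswap := intervalIntegral_integral_swap (μ := ν.restrict A) (a := r) (b := s)
    (f := fun t v => {v : EuclideanSpace ℝ (Fin d) | t < ‖v‖}.indicator (fun v => ‖v‖⁻¹ • v) v) (by
      have : IsFiniteMeasure ((volume : Measure ℝ).restrict (uIoc r s)) := by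
        rw [uIoc_of_le hrs]; infer_instance
      refine Integrable.of_bound (C := 1) ?_ (Eventually.of_forall fun p => ?_)
      · refine Measurable.aestronglyMeasurable ?_
        change Measurable ({p : ℝ × EuclideanSpace ℝ (Fin d) | p.1 < ‖p.2‖}.indicator
          fun p => ‖p.2‖⁻¹ • p.2)
        exact Measurable.indicator (by fun_prop) (measurableSet_lt (by fun_prop) (by fun_prop))
      · exact (norm_indicator_le_norm_self _ _).trans (norm_inv_norm_smul_le _))
  have hleft : ∫ t in r..s, ∫ v in A, {v : EuclideanSpace ℝ (Fin d) | t < ‖v‖}.indicator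
      (fun v => ‖v‖⁻¹ • v) v ∂ν = 0 := by
    rw [← intervalIntegral.integral_zero (a := r) (b := s)]
    refine intervalIntegral.integral_congr fun t ht => ?_
    rw [uIcc_of_le hrs] at ht
    beta_reduce
    rw [setIntegral_indicator (measurableSet_lt measurable_const measurable_norm),
      ← setIntegral_annulus_direction_eq_zero hν hscal hsym (hr.trans_le ht.1) ht.2]
    congr 2
    ext v
    simp only [hA, mem_inter_iff, mem_ofPred_eq]
    exact ⟨fun h => ⟨h.2, h.1.2⟩, fun h => ⟨⟨ht.1.trans_lt h.1, h.2⟩, h.1⟩⟩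
  have hright : ∀ v ∈ A, (∫ t in r..s, {v : EuclideanSpace ℝ (Fin d) | t < ‖v‖}.indicator
      (fun v => ‖v‖⁻¹ • v) v) = v - r • ‖v‖⁻¹ • v := by
    intro v hv
    have h0 : ‖v‖ ≠ 0 := (hr.trans hv.1).ne'
    have : ∀ t : ℝ, {v : EuclideanSpace ℝ (Fin d) | t < ‖v‖}.indicator
        (fun v => ‖v‖⁻¹ • v) v = (Iio ‖v‖).indicator (fun _ => ‖v‖⁻¹ • v) t := fun t => rfl
    simp_rw [this]
    rw [intervalIntegral.integral_of_le hrs, setIntegral_indicator measurableSet_Iio,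
      setIntegral_congr_set (t := Ioc r ‖v‖), setIntegral_const]
    · rw [measureReal_def, Real.volume_Ioc, ENNReal.toReal_ofReal (by linarith [hv.1]), sub_smul,
        smul_smul ‖v‖, mul_inv_cancel₀ h0, one_smul]
    · have : Ioc r s ∩ Iio ‖v‖ = Ioo r ‖v‖ := by
        ext t
        simp only [mem_inter_iff, mem_Ioc, mem_Iio, mem_Ioo]
        exact ⟨fun h => ⟨h.1.1, h.2⟩, fun h => ⟨⟨h.1, h.2.le.trans hv.2⟩, h.2⟩⟩
      rw [this]
      exact Ioo_ae_eq_Ioc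
  rw [hleft, setIntegral_congr_fun hAm hright, integral_sub, integral_smul,
    setIntegral_annulus_direction_eq_zero hν hscal hsym hr hrs, smul_zero, sub_zero] at hswap
  · exact hswap.symm
  · refine Measure.integrableOn_of_bounded (M := s) (measure_ne_top_of_subset subset_rfl ?_)
      (by fun_prop) ?_
    · exact isFiniteMeasure_restrict.1 hfin
    · filter_upwards [ae_restrict_mem hAm] with v hv using hv.2
  · exact hint r

lemma levyExponent_smul (hν : IsLevyMeasure ν)
    (hscal : ∀ c : ℝ, 0 < c → ∀ B : Set (EuclideanSpace ℝ (Fin d)), MeasurableSet B →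
      ν (c • B) = ENNReal.ofReal c⁻¹ * ν B)
    (hsym : (∫ u in {u : EuclideanSpace ℝ (Fin d) | 1 ≤ ‖u‖}, ‖u‖⁻¹ • u ∂ν) = 0)
    {c : ℝ} (hc : 0 < c) (ξ : EuclideanSpace ℝ (Fin d)) :
    levyExponent ν b (c • ξ) = c * levyExponent ν b ξ := by
  have hz : ∀ {r s : ℝ}, 0 < r → ∫ v in {v | r < ‖v‖ ∧ ‖v‖ ≤ s},
      Complex.I * ((⟪ξ, v⟫ : ℝ) : ℂ) ∂ν = 0 := by
    intro r s hr
    rcases lt_or_ge s r with hrs | hrs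
    · have : {v : EuclideanSpace ℝ (Fin d) | r < ‖v‖ ∧ ‖v‖ ≤ s} = ∅ := by
        ext v
        simp only [mem_ofPred_eq, mem_empty_iff_false, iff_false, not_and]
        intro h1 h2
        linarith
      rw [this, setIntegral_empty]
    have hA : ∫ v in {v | r < ‖v‖ ∧ ‖v‖ ≤ s}, (⟪ξ, v⟫ : ℝ) ∂ν = 0 := by
      rw [integral_inner, setIntegral_annulus_eq_zero hν hscal hsym hr hrs, inner_zero_right]
      refine Measure.integrableOn_of_bounded (M := s)
        (ne_top_of_le_ne_top (hν.measure_lt_norm_lt_top hr).ne (measure_mono fun v hv => hv.1))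
        (by fun_prop) ?_
      filter_upwards [ae_restrict_mem ((measurableSet_lt measurable_const measurable_norm).inter
        (measurableSet_le measurable_norm measurable_const))] with v hv using hv.2
    rw [integral_const_mul, integral_complex_ofReal, hA]
    simp
  have hm : ∀ r s : ℝ, MeasurableSet {v : EuclideanSpace ℝ (Fin d) | r < ‖v‖ ∧ ‖v‖ ≤ s} :=
    fun r s => (measurableSet_lt measurable_const measurable_norm).inter
      (measurableSet_le measurable_norm measurable_const)
  have hint : ∀ {r s : ℝ}, 0 < r → IntegrableOn
      (fun v => Complex.I * ((⟪ξ, v⟫ : ℝ) : ℂ)) {v | r < ‖v‖ ∧ ‖v‖ ≤ s} ν := by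
    intro r s hr
    refine Measure.integrableOn_of_bounded (M := ‖ξ‖ * s)
      (ne_top_of_le_ne_top (hν.measure_lt_norm_lt_top hr).ne (measure_mono fun v hv => hv.1))
      (by fun_prop) ?_
    filter_upwards [ae_restrict_mem (hm r s)] with v hv
    have : ‖Complex.I * ((⟪ξ, v⟫ : ℝ) : ℂ)‖ ≤ ‖ξ‖ * ‖v‖ := by
      simpa using abs_real_inner_le_norm ξ v
    exact this.trans (by gcongr; exact hv.2)
  have key : ∀ v : EuclideanSpace ℝ (Fin d), levyKernel (c • ξ) v = levyKernel ξ (c • v)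
      + {v | c < ‖v‖ ∧ ‖v‖ ≤ 1}.indicator (fun v => Complex.I * ((⟪ξ, v⟫ : ℝ) : ℂ)) (c • v)
      - {v | 1 < ‖v‖ ∧ ‖v‖ ≤ c}.indicator (fun v => Complex.I * ((⟪ξ, v⟫ : ℝ) : ℂ)) (c • v) := by
    intro v
    have hn : ‖c • v‖ = c * ‖v‖ := by rw [norm_smul, Real.norm_of_nonneg hc.le]
    have h1 : c < c * ‖v‖ ↔ ¬ ‖v‖ ≤ 1 := by
      rw [lt_mul_iff_one_lt_right hc, not_le]
    have h2 : c * ‖v‖ ≤ c ↔ ‖v‖ ≤ 1 := mul_le_iff_le_one_right hc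
    have h3 : 1 < c * ‖v‖ ↔ ¬ c * ‖v‖ ≤ 1 := not_le.symm
    simp only [levyKernel, indicator, mem_ofPred_eq, hn, h1, h2, h3, real_inner_smul_left,
      real_inner_smul_right]
    by_cases h : ‖v‖ ≤ 1 <;> by_cases h' : c * ‖v‖ ≤ 1 <;> simp [h, h']
  have hA := integral_comp_smul_of_scaling hscal hc (fun v => levyKernel ξ v
      + {v | c < ‖v‖ ∧ ‖v‖ ≤ 1}.indicator (fun v => Complex.I * ((⟪ξ, v⟫ : ℝ) : ℂ)) v
      - {v | 1 < ‖v‖ ∧ ‖v‖ ≤ c}.indicator (fun v => Complex.I * ((⟪ξ, v⟫ : ℝ) : ℂ)) v)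
  have hi1 := (integrable_indicator_iff (hm c 1)).2 (hint (r := c) (s := 1) hc)
  have hi2 := (integrable_indicator_iff (hm 1 c)).2 (hint (r := 1) (s := c) one_pos)
  have hi3 : Integrable (fun v => levyKernel ξ v + {v | c < ‖v‖ ∧ ‖v‖ ≤ 1}.indicator
      (fun v => Complex.I * ((⟪ξ, v⟫ : ℝ) : ℂ)) v) ν := (integrable_levyKernel hν ξ).add hi1
  simp_rw [← key] at hA
  rw [integral_sub hi3 hi2, integral_add (integrable_levyKernel hν ξ) hi1,
    integral_indicator (hm c 1),
    integral_indicator (hm 1 c), hz hc, hz one_pos, add_zero, sub_zero] at hA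
  rw [levyExponent, levyExponent, hA, real_inner_smul_right, Complex.real_smul]
  push_cast
  ring

end Scaling

section FourierSynthesis

variable {d : ℕ} {ν μ : Measure (EuclideanSpace ℝ (Fin d))} {b : EuclideanSpace ℝ (Fin d)}

lemma exists_schwartzMap_eq_integral_exp (F : SchwartzMap (EuclideanSpace ℝ (Fin d)) ℂ)
    {c : ℝ} (hc : c ≠ 0) :
    ∃ f : SchwartzMap (EuclideanSpace ℝ (Fin d)) ℂ,
      ∀ x, f x = ∫ ξ, Complex.exp (Complex.I * ((⟪c • ξ, x⟫ : ℝ) : ℂ)) * F ξ := by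
  have hc' : c / (2 * Real.pi) ≠ 0 := div_ne_zero hc Real.two_pi_pos.ne'
  refine ⟨SchwartzMap.compCLMOfContinuousLinearEquiv ℂ
    (ContinuousLinearEquiv.smulLeft (Units.mk0 _ hc'))
    (FourierTransformInv.fourierInv F), fun x => ?_⟩
  rw [SchwartzMap.compCLMOfContinuousLinearEquiv_apply, SchwartzMap.fourierInv_coe,
    Function.comp_apply, Real.fourierInv_eq']
  congr 1 with ξ
  rw [smul_eq_mul]
  congr 2
  have : ContinuousLinearEquiv.smulLeft (R₁ := ℝ) (Units.mk0 _ hc') x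
      = (c / (2 * Real.pi)) • x := rfl
  rw [this, real_inner_smul_left, real_inner_smul_right]
  push_cast
  field_simp

lemma exists_eq_integral_exp (f : SchwartzMap (EuclideanSpace ℝ (Fin d)) ℂ) :
    ∃ F : SchwartzMap (EuclideanSpace ℝ (Fin d)) ℂ,
      ∀ x, f x = ∫ ξ, Complex.exp (Complex.I * ((⟪ξ, x⟫ : ℝ) : ℂ)) * F ξ := by
  set g := SchwartzMap.compCLMOfContinuousLinearEquiv ℂ
    (ContinuousLinearEquiv.smulLeft (Units.mk0 _ Real.two_pi_pos.ne')) f with hg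
  refine ⟨FourierTransform.fourier g, fun x => ?_⟩
  have h1 : f x = g ((2 * Real.pi)⁻¹ • x) := by
    have : g ((2 * Real.pi)⁻¹ • x) = f ((2 * Real.pi) • (2 * Real.pi)⁻¹ • x) := rfl
    rw [this, smul_smul, mul_inv_cancel₀ Real.two_pi_pos.ne', one_smul]
  have h2 : g ((2 * Real.pi)⁻¹ • x)
      = FourierTransformInv.fourierInv (FourierTransform.fourier g) ((2 * Real.pi)⁻¹ • x) := by
    rw [FourierTransform.fourierInv_fourier_eq]
  rw [h1, h2, SchwartzMap.fourierInv_coe, Real.fourierInv_eq']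
  congr 1 with ξ
  rw [smul_eq_mul, real_inner_smul_right]
  congr 2
  push_cast
  field_simp

lemma integrable_one_add_sq_mul_norm (F : SchwartzMap (EuclideanSpace ℝ (Fin d)) ℂ) (c : ℝ) :
    Integrable (fun ξ => (1 + ‖c • ξ‖ ^ 2) * ‖F ξ‖) := by
  have h0 := F.integrable_pow_mul volume 0
  have h2 := (F.integrable_pow_mul volume 2).const_mul (|c| ^ 2)
  refine (h0.add h2).congr (Eventually.of_forall fun ξ => ?_)
  simp only [Pi.add_apply, norm_smul, Real.norm_eq_abs]
  ring

lemma integrable_exp_mul (F : SchwartzMap (EuclideanSpace ℝ (Fin d)) ℂ) (c : ℝ)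
    (x : EuclideanSpace ℝ (Fin d)) :
    Integrable (fun ξ => Complex.exp (Complex.I * ((⟪c • ξ, x⟫ : ℝ) : ℂ)) * F ξ) := by
  refine F.integrable.bdd_mul (c := 1) (by fun_prop) (Eventually.of_forall fun ξ => ?_)
  rw [norm_exp_I_mul_ofReal]

lemma norm_I_mul_inner_le (ξ v : EuclideanSpace ℝ (Fin d)) :
    ‖Complex.I * ((⟪ξ, v⟫ : ℝ) : ℂ)‖ ≤ ‖v‖ * (1 + ‖ξ‖ ^ 2) := by
  have h : ‖Complex.I * ((⟪ξ, v⟫ : ℝ) : ℂ)‖ ≤ ‖ξ‖ * ‖v‖ := by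
    simpa using abs_real_inner_le_norm ξ v
  nlinarith [mul_nonneg (norm_nonneg v) (sq_nonneg (‖ξ‖ - 1)),
    mul_nonneg (norm_nonneg v) (sq_nonneg ‖ξ‖), norm_nonneg v]

lemma integrable_exp_mul_inner_mul (F : SchwartzMap (EuclideanSpace ℝ (Fin d)) ℂ) (c : ℝ)
    (x v : EuclideanSpace ℝ (Fin d)) :
    Integrable (fun ξ => Complex.exp (Complex.I * ((⟪c • ξ, x⟫ : ℝ) : ℂ))
      * (Complex.I * ((⟪c • ξ, v⟫ : ℝ) : ℂ)) * F ξ) := by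
  refine ((integrable_one_add_sq_mul_norm F c).const_mul ‖v‖).mono'
    (by fun_prop) (Eventually.of_forall fun ξ => ?_)
  rw [norm_mul, norm_mul, norm_exp_I_mul_ofReal, one_mul, ← mul_assoc]
  gcongr
  exact norm_I_mul_inner_le _ _

lemma fderiv_eq_integral_exp {F f : SchwartzMap (EuclideanSpace ℝ (Fin d)) ℂ} {c : ℝ}
    (hf : ∀ x, f x = ∫ ξ, Complex.exp (Complex.I * ((⟪c • ξ, x⟫ : ℝ) : ℂ)) * F ξ)
    (x v : EuclideanSpace ℝ (Fin d)) :
    fderiv ℝ f x v = ∫ ξ, Complex.exp (Complex.I * ((⟪c • ξ, x⟫ : ℝ) : ℂ))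
      * (Complex.I * ((⟪c • ξ, v⟫ : ℝ) : ℂ)) * F ξ := by
  have hline : HasDerivAt (fun t : ℝ => x + t • v) v 0 := by
    simpa using ((hasDerivAt_id (0 : ℝ)).smul_const v).const_add x
  have h1 : HasDerivAt (fun t : ℝ => f (x + t • v)) (fderiv ℝ f x v) 0 := by
    have hfd : HasFDerivAt f (fderiv ℝ f x) (x + (0 : ℝ) • v) := by
      simpa using f.differentiableAt.hasFDerivAt
    exact hfd.comp_hasDerivAt 0 hline
  have h2 := (hasDerivAt_integral_of_dominated_loc_of_deriv_le (μ := volume) (x₀ := (0 : ℝ))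
    (s := univ)
    (F := fun t ξ => Complex.exp (Complex.I * ((⟪c • ξ, x + t • v⟫ : ℝ) : ℂ)) * F ξ)
    (F' := fun t ξ => Complex.exp (Complex.I * ((⟪c • ξ, x + t • v⟫ : ℝ) : ℂ))
      * (Complex.I * ((⟪c • ξ, v⟫ : ℝ) : ℂ)) * F ξ)
    (bound := fun ξ => ‖v‖ * ((1 + ‖c • ξ‖ ^ 2) * ‖F ξ‖)) univ_mem
    (Eventually.of_forall fun t => (integrable_exp_mul F c _).aestronglyMeasurable)
    (integrable_exp_mul F c _) (integrable_exp_mul_inner_mul F c _ _).aestronglyMeasurable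
    (Eventually.of_forall fun ξ t _ => by
      rw [norm_mul, norm_mul, norm_exp_I_mul_ofReal, one_mul, ← mul_assoc]
      gcongr
      exact norm_I_mul_inner_le _ _)
    ((integrable_one_add_sq_mul_norm F c).const_mul ‖v‖)
    (Eventually.of_forall fun ξ t _ => by
      have h3 : HasDerivAt (fun t : ℝ => (⟪c • ξ, x + t • v⟫ : ℝ)) ⟪c • ξ, v⟫ t := by
        have := ((hasDerivAt_id t).mul_const (⟪c • ξ, v⟫ : ℝ)).const_add (⟪c • ξ, x⟫ : ℝ)
        simpa [inner_add_right, real_inner_smul_right] using this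
      exact ((h3.ofReal_comp.const_mul Complex.I).cexp).mul_const (F ξ))).2
  have h3 := h1.unique (by simpa only [hf] using h2)
  simpa using h3

/-- The truncated increment occurring in the nonlocal part of the Stein identity. -/
def truncatedIncrement {G : Type*} [NormedAddCommGroup G] [NormedSpace ℝ G]
    (f : EuclideanSpace ℝ (Fin d) → G) (x u : EuclideanSpace ℝ (Fin d)) : G :=
  f (x + u) - f x - (if ‖u‖ ≤ 1 then fderiv ℝ f x u else 0)

lemma norm_levyKernel_mul_le (F : SchwartzMap (EuclideanSpace ℝ (Fin d)) ℂ) (c : ℝ)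
    (x ξ u : EuclideanSpace ℝ (Fin d)) :
    ‖Complex.exp (Complex.I * ((⟪c • ξ, x⟫ : ℝ) : ℂ)) * levyKernel (c • ξ) u * F ξ‖
      ≤ 3 * ((1 + ‖c • ξ‖ ^ 2) * ‖F ξ‖) * min 1 (‖u‖ ^ 2) := by
  rw [norm_mul, norm_mul, norm_exp_I_mul_ofReal, one_mul]
  refine (mul_le_mul_of_nonneg_right (norm_levyKernel_le _ _) (norm_nonneg _)).trans_eq ?_
  ring

lemma truncatedIncrement_eq_integral {F f : SchwartzMap (EuclideanSpace ℝ (Fin d)) ℂ} {c : ℝ}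
    (hf : ∀ x, f x = ∫ ξ, Complex.exp (Complex.I * ((⟪c • ξ, x⟫ : ℝ) : ℂ)) * F ξ)
    (x u : EuclideanSpace ℝ (Fin d)) :
    truncatedIncrement f x u
      = ∫ ξ, Complex.exp (Complex.I * ((⟪c • ξ, x⟫ : ℝ) : ℂ)) * levyKernel (c • ξ) u * F ξ := by
  have hexp : ∀ ξ, Complex.exp (Complex.I * ((⟪c • ξ, x + u⟫ : ℝ) : ℂ))
      = Complex.exp (Complex.I * ((⟪c • ξ, x⟫ : ℝ) : ℂ))
        * Complex.exp (Complex.I * ((⟪c • ξ, u⟫ : ℝ) : ℂ)) := fun ξ => by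
    rw [← Complex.exp_add, inner_add_right]
    push_cast
    ring_nf
  have hsub : Integrable (fun ξ => Complex.exp (Complex.I * ((⟪c • ξ, x + u⟫ : ℝ) : ℂ)) * F ξ
      - Complex.exp (Complex.I * ((⟪c • ξ, x⟫ : ℝ) : ℂ)) * F ξ) :=
    (integrable_exp_mul F c _).sub (integrable_exp_mul F c _)
  unfold truncatedIncrement
  rw [hf, hf, ← integral_sub (integrable_exp_mul F c _) (integrable_exp_mul F c _)]
  unfold levyKernel
  split_ifs with h
  · rw [fderiv_eq_integral_exp hf, ← integral_sub hsub (integrable_exp_mul_inner_mul F c _ _)]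
    congr 1 with ξ
    rw [hexp]
    ring
  · rw [sub_zero]
    congr 1 with ξ
    rw [hexp]
    ring

lemma norm_truncatedIncrement_le (f : SchwartzMap (EuclideanSpace ℝ (Fin d)) ℂ) :
    ∃ C : ℝ, ∀ x u, ‖truncatedIncrement f x u‖ ≤ C * min 1 (‖u‖ ^ 2) := by
  obtain ⟨F, hF⟩ := exists_eq_integral_exp f
  refine ⟨∫ ξ, 3 * ((1 + ‖(1 : ℝ) • ξ‖ ^ 2) * ‖F ξ‖), fun x u => ?_⟩
  rw [truncatedIncrement_eq_integral (F := F) (c := 1) (by simpa using hF), ← integral_mul_const]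
  exact norm_integral_le_of_norm_le
    (((integrable_one_add_sq_mul_norm F 1).const_mul 3).mul_const _)
    (Eventually.of_forall fun ξ => norm_levyKernel_mul_le F 1 x ξ u)

lemma integral_truncatedIncrement (hν : IsLevyMeasure ν)
    {F f : SchwartzMap (EuclideanSpace ℝ (Fin d)) ℂ} {c : ℝ}
    (hf : ∀ x, f x = ∫ ξ, Complex.exp (Complex.I * ((⟪c • ξ, x⟫ : ℝ) : ℂ)) * F ξ)
    (x : EuclideanSpace ℝ (Fin d)) :
    fderiv ℝ f x b + ∫ u, truncatedIncrement f x u ∂ν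
      = ∫ ξ, Complex.exp (Complex.I * ((⟪c • ξ, x⟫ : ℝ) : ℂ))
          * (levyExponent ν b (c • ξ) * F ξ) := by
  have := hν.sigmaFinite
  have hint : Integrable (Function.uncurry fun u ξ : EuclideanSpace ℝ (Fin d) =>
      Complex.exp (Complex.I * ((⟪c • ξ, x⟫ : ℝ) : ℂ)) * levyKernel (c • ξ) u * F ξ)
      (ν.prod volume) := by
    refine (hν.integrable_min.mul_prod
      ((integrable_one_add_sq_mul_norm F c).const_mul 3)).mono' ?_
      (Eventually.of_forall fun p => ?_)
    · have h1 : Measurable fun p : EuclideanSpace ℝ (Fin d) × EuclideanSpace ℝ (Fin d) =>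
          levyKernel (c • p.2) p.1 :=
        measurable_levyKernel_comp (measurable_snd.const_smul c) measurable_fst
      have h2 : Measurable fun p : EuclideanSpace ℝ (Fin d) × EuclideanSpace ℝ (Fin d) => F p.2 :=
        F.continuous.measurable.comp measurable_snd
      have h3 : Measurable fun p : EuclideanSpace ℝ (Fin d) × EuclideanSpace ℝ (Fin d) =>
          Complex.exp (Complex.I * ((⟪c • p.2, x⟫ : ℝ) : ℂ)) :=
        Continuous.measurable (by fun_prop)
      exact ((h3.mul h1).mul h2).aestronglyMeasurable
    · exact (norm_levyKernel_mul_le F c x p.2 p.1).trans_eq (mul_comm _ _)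
  simp_rw [truncatedIncrement_eq_integral hf]
  have hint' : Integrable (fun ξ => ∫ u, Complex.exp (Complex.I * ((⟪c • ξ, x⟫ : ℝ) : ℂ))
      * levyKernel (c • ξ) u * F ξ ∂ν) := hint.integral_prod_right
  rw [integral_integral_swap hint, fderiv_eq_integral_exp hf,
    ← integral_add (integrable_exp_mul_inner_mul F c _ _) hint']
  congr 1 with ξ
  rw [integral_mul_const, integral_const_mul, levyExponent, real_inner_comm b]
  ring

lemma integrable_levyExponent_mul (hν : IsLevyMeasure ν)
    (F : SchwartzMap (EuclideanSpace ℝ (Fin d)) ℂ) (c : ℝ) :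
    Integrable (fun ξ => levyExponent ν b (c • ξ) * F ξ) := by
  obtain ⟨C, hC⟩ := exists_norm_levyExponent_le (b := b) hν
  have := continuous_levyExponent (b := b) hν
  refine ((integrable_one_add_sq_mul_norm F c).const_mul C).mono'
    (by fun_prop) (Eventually.of_forall fun ξ => ?_)
  rw [norm_mul, ← mul_assoc]
  gcongr
  exact hC _

lemma integral_integral_exp_mul [IsProbabilityMeasure μ] (c : ℝ)
    {G : EuclideanSpace ℝ (Fin d) → ℂ} (hG : Integrable G) :
    ∫ x, ∫ ξ, Complex.exp (Complex.I * ((⟪c • ξ, x⟫ : ℝ) : ℂ)) * G ξ ∂volume ∂μ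
      = ∫ ξ, charFn μ (c • ξ) * G ξ := by
  rw [integral_integral_swap]
  · simp_rw [integral_mul_const]
    rfl
  · refine (hG.comp_snd μ).bdd_mul (c := 1) (by fun_prop) (Eventually.of_forall fun p => ?_)
    rw [norm_exp_I_mul_ofReal]

end FourierSynthesis

section SteinIdentity

variable {d : ℕ} {ν μ : Measure (EuclideanSpace ℝ (Fin d))} {b : EuclideanSpace ℝ (Fin d)}

lemma charFn_eq_charFun : charFn μ = charFun μ := by
  ext ξ
  rw [charFun_apply, charFn]
  congr 1 with x
  rw [mul_comm, real_inner_comm]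

lemma continuous_charFn [IsProbabilityMeasure μ] : Continuous (charFn μ) := by
  rw [charFn_eq_charFun]
  exact continuous_charFun

lemma norm_charFn_le_one [IsProbabilityMeasure μ] (ξ : EuclideanSpace ℝ (Fin d)) :
    ‖charFn μ ξ‖ ≤ 1 := by
  rw [charFn_eq_charFun]
  exact norm_charFun_le_one ξ

lemma charFn_zero [IsProbabilityMeasure μ] : charFn μ 0 = 1 := by
  simp [charFn]

lemma exists_norm_fderiv_le {G : Type*} [NormedAddCommGroup G] [NormedSpace ℝ G]
    (f : SchwartzMap (EuclideanSpace ℝ (Fin d)) G) :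
    ∃ C : ℝ, ∀ x, ‖fderiv ℝ f x‖ ≤ C := by
  obtain ⟨C, -, hC⟩ := f.decay 0 1
  exact ⟨C, fun x => by simpa [norm_iteratedFDeriv_one] using hC x⟩

lemma exists_norm_fderiv_apply_self_le {G : Type*} [NormedAddCommGroup G] [NormedSpace ℝ G]
    (f : SchwartzMap (EuclideanSpace ℝ (Fin d)) G) :
    ∃ C : ℝ, 0 ≤ C ∧ ∀ x, ‖fderiv ℝ f x x‖ ≤ C := by
  obtain ⟨C, -, hC⟩ := f.decay 1 1
  have h : ∀ x, ‖fderiv ℝ f x x‖ ≤ C := fun x => by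
    refine ((fderiv ℝ f x).le_opNorm x).trans ?_
    simpa [norm_iteratedFDeriv_one, mul_comm] using hC x
  exact ⟨C, (norm_nonneg _).trans (h 0), h⟩

lemma continuous_fderiv_schwartz {G : Type*} [NormedAddCommGroup G] [NormedSpace ℝ G]
    (f : SchwartzMap (EuclideanSpace ℝ (Fin d)) G) : Continuous (fderiv ℝ f) :=
  (f.smooth 1).continuous_fderiv (by simp)

lemma hasDerivAt_integral_comp_smul [IsProbabilityMeasure μ]
    (f : SchwartzMap (EuclideanSpace ℝ (Fin d)) ℂ) {t : ℝ} (ht : 0 < t) :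
    HasDerivAt (fun s : ℝ => ∫ x, f (s • x) ∂μ) (∫ x, fderiv ℝ f (t • x) x ∂μ) t := by
  obtain ⟨C, hC0, hC⟩ := exists_norm_fderiv_apply_self_le f
  have hcont := f.continuous
  have hcont' := continuous_fderiv_schwartz f
  obtain ⟨K, -, hK⟩ := f.decay 0 0
  refine (hasDerivAt_integral_of_dominated_loc_of_deriv_le (μ := μ) (s := Ioi (t / 2))
    (F' := fun s x => fderiv ℝ f (s • x) x) (bound := fun _ => C / (t / 2))
    (Ioi_mem_nhds (by linarith))
    (Eventually.of_forall fun s => by fun_prop) ?_ (by fun_prop) ?_ (integrable_const _) ?_).2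
  · refine Integrable.of_bound (by fun_prop) K (Eventually.of_forall fun x => ?_)
    simpa using hK (t • x)
  · refine Eventually.of_forall fun x s (hs : t / 2 < s) => ?_
    have hs0 : 0 < s := by linarith
    rw [le_div_iff₀ (by linarith)]
    have h := hC (s • x)
    rw [map_smul, norm_smul, Real.norm_of_nonneg hs0.le] at h
    nlinarith [norm_nonneg (fderiv ℝ f (s • x) x)]
  · refine Eventually.of_forall fun x s _ => ?_
    have h : HasDerivAt (fun s : ℝ => s • x) x s := by
      simpa using (hasDerivAt_id s).smul_const x
    exact (f.differentiableAt.hasFDerivAt (x := s • x)).comp_hasDerivAt s h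

/-- The Stein identity for a complex-valued test function, in terms of the Fréchet derivative. -/
def SteinIdentity (μ ν : Measure (EuclideanSpace ℝ (Fin d))) (b : EuclideanSpace ℝ (Fin d))
    {G : Type*} [NormedAddCommGroup G] [NormedSpace ℝ G]
    (f : SchwartzMap (EuclideanSpace ℝ (Fin d)) G) : Prop :=
  ∫ x, fderiv ℝ f x x ∂μ
    = ∫ x, (fderiv ℝ f x b + ∫ u, truncatedIncrement f x u ∂ν) ∂μ

lemma integral_steinOperator [IsProbabilityMeasure μ] (hν : IsLevyMeasure ν)
    {F f : SchwartzMap (EuclideanSpace ℝ (Fin d)) ℂ} {c : ℝ}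
    (hf : ∀ x, f x = ∫ ξ, Complex.exp (Complex.I * ((⟪c • ξ, x⟫ : ℝ) : ℂ)) * F ξ) :
    ∫ x, (fderiv ℝ f x b + ∫ u, truncatedIncrement f x u ∂ν) ∂μ
      = ∫ ξ, charFn μ (c • ξ) * (levyExponent ν b (c • ξ) * F ξ) := by
  rw [← integral_integral_exp_mul c (integrable_levyExponent_mul hν F c)]
  simp_rw [integral_truncatedIncrement hν hf]

lemma integral_comp_smul_eq [IsProbabilityMeasure μ]
    {F f : SchwartzMap (EuclideanSpace ℝ (Fin d)) ℂ}
    (hf : ∀ x, f x = ∫ ξ, Complex.exp (Complex.I * ((⟪(1 : ℝ) • ξ, x⟫ : ℝ) : ℂ)) * F ξ) (s : ℝ) :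
    ∫ x, f (s • x) ∂μ = ∫ ξ, charFn μ (s • ξ) * F ξ := by
  rw [← integral_integral_exp_mul s F.integrable]
  simp_rw [hf, one_smul, real_inner_smul_left, real_inner_smul_right]

lemma hasDerivAt_integral_charFn [IsProbabilityMeasure μ] (hν : IsLevyMeasure ν)
    (hψ : ∀ c : ℝ, 0 < c → ∀ ξ, levyExponent ν b (c • ξ) = c * levyExponent ν b ξ)
    (hS : ∀ f : SchwartzMap (EuclideanSpace ℝ (Fin d)) ℂ, SteinIdentity μ ν b f)
    (F : SchwartzMap (EuclideanSpace ℝ (Fin d)) ℂ) {t : ℝ} (ht : 0 < t) :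
    HasDerivAt (fun s : ℝ => ∫ ξ, charFn μ (s • ξ) * F ξ)
      (∫ ξ, charFn μ (t • ξ) * (levyExponent ν b ξ * F ξ)) t := by
  obtain ⟨f, hf⟩ := exists_schwartzMap_eq_integral_exp F one_ne_zero
  obtain ⟨g, hg⟩ := exists_schwartzMap_eq_integral_exp F ht.ne'
  have hgf : ⇑g = fun x => f (t • x) := by
    ext x
    simp_rw [hg, hf, one_smul, real_inner_smul_left, real_inner_smul_right]
  have hderiv : ∀ x, fderiv ℝ g x x = t * fderiv ℝ f (t • x) x := by
    intro x
    rw [hgf, fderiv_comp_smul]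
    simp
  have h := hasDerivAt_integral_comp_smul (μ := μ) f ht
  have hS' := hS g
  rw [SteinIdentity, integral_steinOperator hν hg] at hS'
  simp_rw [hderiv, hψ t ht] at hS'
  simp_rw [integral_comp_smul_eq hf] at h
  convert h using 1
  have ht' : (t : ℂ) ≠ 0 := by exact_mod_cast ht.ne'
  refine mul_left_cancel₀ ht' ?_
  rw [← integral_const_mul, ← integral_const_mul, hS']
  congr 1 with ξ
  ring

lemma charFn_smul_eq_add_integral [IsProbabilityMeasure μ] (hν : IsLevyMeasure ν)
    (hψ : ∀ c : ℝ, 0 < c → ∀ ξ, levyExponent ν b (c • ξ) = c * levyExponent ν b ξ)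
    (hS : ∀ f : SchwartzMap (EuclideanSpace ℝ (Fin d)) ℂ, SteinIdentity μ ν b f)
    {t : ℝ} (ht : 0 ≤ t) (ξ : EuclideanSpace ℝ (Fin d)) :
    charFn μ (t • ξ) = 1 + levyExponent ν b ξ * ∫ s in (0 : ℝ)..t, charFn μ (s • ξ) := by
  have hφ := continuous_charFn (μ := μ)
  have hψc := continuous_levyExponent (b := b) hν
  set h : EuclideanSpace ℝ (Fin d) → ℂ := fun ξ =>
    charFn μ (t • ξ) - (1 + levyExponent ν b ξ * ∫ s in (0 : ℝ)..t, charFn μ (s • ξ)) with hh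
  have hI : Continuous fun ξ => ∫ s in (0 : ℝ)..t, charFn μ (s • ξ) :=
    intervalIntegral.continuous_parametric_intervalIntegral_of_continuous' (by fun_prop) 0 t
  have hcont : Continuous h := by fun_prop
  suffices h0 : h = 0 by
    have := congrFun h0 ξ
    exact sub_eq_zero.1 this
  refine (hcont.ae_eq_iff_eq volume continuous_zero).1 ?_
  refine ae_eq_zero_of_integral_contDiff_smul_eq_zero hcont.locallyIntegrable fun g hg hgs => ?_
  set F : SchwartzMap (EuclideanSpace ℝ (Fin d)) ℂ :=
    (hgs.comp_left (g := Complex.ofRealCLM) (map_zero _)).toSchwartzMap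
      (Complex.ofRealCLM.contDiff.comp hg) with hF
  have hFg : ∀ ξ, F ξ = (g ξ : ℂ) := fun ξ => rfl
  have hFc := F.continuous
  have hψF : Integrable (fun ξ => levyExponent ν b ξ * F ξ) := by
    simpa using integrable_levyExponent_mul (b := b) hν F 1
  have hφF : ∀ s : ℝ, Integrable (fun ξ => charFn μ (s • ξ) * F ξ) := fun s =>
    F.integrable.bdd_mul (c := 1) (by fun_prop) (Eventually.of_forall fun ξ => norm_charFn_le_one _)
  have hc1 : Continuous fun s : ℝ => ∫ ξ, charFn μ (s • ξ) * F ξ :=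
    continuous_of_dominated (bound := fun ξ => ‖F ξ‖) (fun s => (hφF s).aestronglyMeasurable)
      (fun s => Eventually.of_forall fun ξ => by
        rw [norm_mul]
        exact mul_le_of_le_one_left (norm_nonneg _) (norm_charFn_le_one _))
      F.integrable.norm (Eventually.of_forall fun ξ => by fun_prop)
  have hc2 : Continuous fun s : ℝ => ∫ ξ, charFn μ (s • ξ) * (levyExponent ν b ξ * F ξ) :=
    continuous_of_dominated (bound := fun ξ => ‖levyExponent ν b ξ * F ξ‖)
      (fun s => by fun_prop)
      (fun s => Eventually.of_forall fun ξ => by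
        rw [norm_mul]
        exact mul_le_of_le_one_left (norm_nonneg _) (norm_charFn_le_one _))
      hψF.norm (Eventually.of_forall fun ξ => by fun_prop)
  have hftc := intervalIntegral.integral_eq_sub_of_hasDerivAt_of_le ht hc1.continuousOn
    (fun s hs => hasDerivAt_integral_charFn hν hψ hS F hs.1) (hc2.intervalIntegrable 0 t)
  have hprod : Integrable (Function.uncurry fun (s : ℝ) ξ =>
      charFn μ (s • ξ) * (levyExponent ν b ξ * F ξ))
      (((volume : Measure ℝ).restrict (uIoc 0 t)).prod volume) := by
    have : IsFiniteMeasure ((volume : Measure ℝ).restrict (uIoc 0 t)) := by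
      rw [uIoc_of_le ht]; infer_instance
    exact (hψF.comp_snd _).bdd_mul (c := 1) (by fun_prop)
      (Eventually.of_forall fun p => norm_charFn_le_one _)
  rw [intervalIntegral_integral_swap hprod] at hftc
  simp only [zero_smul, charFn_zero, one_mul] at hftc
  have hprod' : Integrable (fun ξ => ∫ s in (0 : ℝ)..t,
      charFn μ (s • ξ) * (levyExponent ν b ξ * F ξ)) := by
    have := hprod.integral_prod_right
    simpa only [intervalIntegral.integral_of_le ht, uIoc_of_le ht, Function.uncurry] using this
  have hexp : ∀ ξ, g ξ • h ξ = charFn μ (t • ξ) * F ξ - F ξ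
      - ∫ s in (0 : ℝ)..t, charFn μ (s • ξ) * (levyExponent ν b ξ * F ξ) := by
    intro ξ
    rw [intervalIntegral.integral_mul_const, hFg, hh, Complex.real_smul]
    ring
  simp_rw [hexp]
  have h1 : Integrable (fun ξ => charFn μ (t • ξ) * F ξ - F ξ) := (hφF t).sub F.integrable
  rw [integral_sub h1 hprod', integral_sub (hφF t) F.integrable, hftc, sub_self]

lemma charFn_eq_exp_of_steinIdentity [IsProbabilityMeasure μ] (hν : IsLevyMeasure ν)
    (hψ : ∀ c : ℝ, 0 < c → ∀ ξ, levyExponent ν b (c • ξ) = c * levyExponent ν b ξ)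
    (hS : ∀ f : SchwartzMap (EuclideanSpace ℝ (Fin d)) ℂ, SteinIdentity μ ν b f)
    (ξ : EuclideanSpace ℝ (Fin d)) :
    charFn μ ξ = Complex.exp (levyExponent ν b ξ) := by
  have hφ := continuous_charFn (μ := μ)
  set a := levyExponent ν b ξ with ha
  set Y : ℝ → ℂ := fun t => 1 + a * ∫ s in (0 : ℝ)..t, charFn μ (s • ξ) with hY
  have hYd : ∀ t, HasDerivAt Y (a * charFn μ (t • ξ)) t := fun t =>
    ((intervalIntegral.integral_hasDerivAt_right
      ((by fun_prop : Continuous fun s : ℝ => charFn μ (s • ξ)).intervalIntegrable 0 t)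
      ((by fun_prop : Continuous fun s : ℝ => charFn μ (s • ξ)).stronglyMeasurableAtFilter _ _)
      (by fun_prop : Continuous fun s : ℝ => charFn μ (s • ξ)).continuousAt).const_mul
        a).const_add 1
  have hEd : ∀ t : ℝ, HasDerivAt (fun t : ℝ => Complex.exp (-(a * t))) 
      (Complex.exp (-(a * t)) * (-(a * 1))) t := fun t =>
    (((Complex.ofRealCLM.hasDerivAt (x := t)).const_mul a).neg).cexp
  have hYφ : ∀ t, 0 ≤ t → charFn μ (t • ξ) = Y t := fun t ht =>
    charFn_smul_eq_add_integral hν hψ hS ht ξ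
  have hconst := constant_of_has_deriv_right_zero (a := 0) (b := 1)
    (f := fun t => Y t * Complex.exp (-(a * t)))
    (fun t _ => ((hYd t).mul (hEd t)).continuousAt.continuousWithinAt)
    (fun t ht => by
      have h := ((hYd t).mul (hEd t)).hasDerivWithinAt (s := Ici t)
      have h0 : a * charFn μ (t • ξ) * Complex.exp (-(a * t))
          + Y t * (Complex.exp (-(a * t)) * (-(a * 1))) = 0 := by
        rw [hYφ t ht.1]
        ring
      rw [h0] at h
      exact h) 1 (by simp)
  have hY0 : Y 0 = 1 := by simp [hY]
  rw [hY0, ← hYφ 1 zero_le_one] at hconst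
  simp only [one_smul, Complex.ofReal_one, mul_one, Complex.ofReal_zero, mul_zero, neg_zero,
    Complex.exp_zero, Complex.exp_neg] at hconst
  rwa [← div_eq_mul_inv, div_eq_one_iff_eq (Complex.exp_ne_zero _)] at hconst

lemma steinIdentity_of_charFn_eq_exp [IsProbabilityMeasure μ] (hν : IsLevyMeasure ν)
    (hψ : ∀ c : ℝ, 0 < c → ∀ ξ, levyExponent ν b (c • ξ) = c * levyExponent ν b ξ)
    (hμ : ∀ ξ, charFn μ ξ = Complex.exp (levyExponent ν b ξ))
    (f : SchwartzMap (EuclideanSpace ℝ (Fin d)) ℂ) : SteinIdentity μ ν b f := by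
  obtain ⟨F, hF⟩ := exists_eq_integral_exp f
  have hf : ∀ x, f x = ∫ ξ, Complex.exp (Complex.I * ((⟪(1 : ℝ) • ξ, x⟫ : ℝ) : ℂ)) * F ξ := by
    simpa using hF
  have hφ := continuous_charFn (μ := μ)
  have hψF : Integrable (fun ξ => levyExponent ν b ξ * F ξ) := by
    simpa using integrable_levyExponent_mul (b := b) hν F 1
  have h1 := hasDerivAt_integral_comp_smul (μ := μ) f one_pos
  simp_rw [integral_comp_smul_eq hf, one_smul] at h1
  have hFc := F.continuous
  have hψc := continuous_levyExponent (b := b) hν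
  have hexp : ∀ s : ℝ, 0 < s → ∀ ξ, charFn μ (s • ξ) = Complex.exp (s * levyExponent ν b ξ) :=
    fun s hs ξ => by rw [hμ, hψ s hs]
  have h2 := (hasDerivAt_integral_of_dominated_loc_of_deriv_le (μ := volume) (x₀ := (1 : ℝ))
    (s := Ioi 0)
    (F := fun (s : ℝ) ξ => Complex.exp (s * levyExponent ν b ξ) * F ξ)
    (F' := fun (s : ℝ) ξ => Complex.exp (s * levyExponent ν b ξ) * (levyExponent ν b ξ * F ξ))
    (bound := fun ξ => ‖levyExponent ν b ξ * F ξ‖) (Ioi_mem_nhds one_pos)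
    (Eventually.of_forall fun s => by fun_prop)
    (F.integrable.bdd_mul (c := 1) (by fun_prop) (Eventually.of_forall fun ξ => by
      rw [← hexp 1 one_pos]; exact norm_charFn_le_one _))
    (by fun_prop)
    (Eventually.of_forall fun ξ s hs => by
      rw [norm_mul, ← hexp s hs]
      exact mul_le_of_le_one_left (norm_nonneg _) (norm_charFn_le_one _))
    hψF.norm
    (Eventually.of_forall fun ξ s _ => by
      have := ((((Complex.ofRealCLM.hasDerivAt (x := s)).mul_const
        (levyExponent ν b ξ))).cexp).mul_const (F ξ)
      simpa [mul_assoc] using this)).2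
  have h3 : (fun s : ℝ => ∫ ξ, charFn μ (s • ξ) * F ξ)
      =ᶠ[𝓝 1] fun s : ℝ => ∫ ξ, Complex.exp (s * levyExponent ν b ξ) * F ξ := by
    filter_upwards [Ioi_mem_nhds one_pos] with s hs
    simp_rw [hexp s hs]
  have h4 := h1.unique (h2.congr_of_eventuallyEq h3)
  rw [SteinIdentity, integral_steinOperator hν hf, h4]
  simp_rw [hexp 1 one_pos, one_smul]

end SteinIdentity

section RealComplex

variable {d : ℕ} {ν μ : Measure (EuclideanSpace ℝ (Fin d))} {b : EuclideanSpace ℝ (Fin d)}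

lemma integrable_truncatedIncrement [IsProbabilityMeasure μ] (hν : IsLevyMeasure ν)
    (f : SchwartzMap (EuclideanSpace ℝ (Fin d)) ℂ) :
    Integrable (fun p : EuclideanSpace ℝ (Fin d) × EuclideanSpace ℝ (Fin d) =>
      truncatedIncrement f p.1 p.2) (μ.prod ν) := by
  have := hν.sigmaFinite
  obtain ⟨C, hC⟩ := norm_truncatedIncrement_le f
  have hcont := f.continuous
  have hcont' := continuous_fderiv_schwartz f
  refine ((hν.integrable_min.comp_snd μ).const_mul C).mono' ?_
    (Eventually.of_forall fun p => hC p.1 p.2)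
  refine Measurable.aestronglyMeasurable ?_
  have h1 : Continuous fun p : EuclideanSpace ℝ (Fin d) × EuclideanSpace ℝ (Fin d) =>
      f (p.1 + p.2) - f p.1 := by fun_prop
  have h2 : Continuous fun p : EuclideanSpace ℝ (Fin d) × EuclideanSpace ℝ (Fin d) =>
      fderiv ℝ f p.1 p.2 := by fun_prop
  exact h1.measurable.sub (Measurable.ite (measurableSet_le (by fun_prop) measurable_const)
    h2.measurable measurable_const)

lemma integrable_fderiv_apply [IsProbabilityMeasure μ] {G : Type*} [NormedAddCommGroup G]
    [NormedSpace ℝ G] [SecondCountableTopology G]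
    (f : SchwartzMap (EuclideanSpace ℝ (Fin d)) G) (v : EuclideanSpace ℝ (Fin d)) :
    Integrable (fun x => fderiv ℝ f x v) μ := by
  obtain ⟨C, hC⟩ := exists_norm_fderiv_le f
  have hcont' := continuous_fderiv_schwartz f
  exact Integrable.of_bound (Continuous.aestronglyMeasurable (by fun_prop)) (C * ‖v‖)
    (Eventually.of_forall fun x => (fderiv ℝ f x).le_of_opNorm_le (hC x) v)

lemma fderiv_apply_eq_clm (L : ℂ →L[ℝ] ℝ) {f : SchwartzMap (EuclideanSpace ℝ (Fin d)) ℂ}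
    {g : SchwartzMap (EuclideanSpace ℝ (Fin d)) ℝ} (hgf : ∀ x, g x = L (f x))
    (x v : EuclideanSpace ℝ (Fin d)) : fderiv ℝ g x v = L (fderiv ℝ f x v) := by
  have : ⇑g = L ∘ f := funext hgf
  rw [this, (L.hasFDerivAt.comp x f.differentiableAt.hasFDerivAt).fderiv]
  rfl

lemma truncatedIncrement_eq_clm (L : ℂ →L[ℝ] ℝ) {f : SchwartzMap (EuclideanSpace ℝ (Fin d)) ℂ}
    {g : SchwartzMap (EuclideanSpace ℝ (Fin d)) ℝ} (hgf : ∀ x, g x = L (f x))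
    (x u : EuclideanSpace ℝ (Fin d)) :
    truncatedIncrement g x u = L (truncatedIncrement f x u) := by
  unfold truncatedIncrement
  rw [hgf, hgf, fderiv_apply_eq_clm L hgf, map_sub, map_sub, apply_ite L, map_zero]

/-- Both sides of the Stein identity commute with real-linear functionals of the test function. -/
lemma integral_stein_comp_clm [IsProbabilityMeasure μ] (hν : IsLevyMeasure ν)
    (L : ℂ →L[ℝ] ℝ) {f : SchwartzMap (EuclideanSpace ℝ (Fin d)) ℂ}
    {g : SchwartzMap (EuclideanSpace ℝ (Fin d)) ℝ} (hgf : ∀ x, g x = L (f x)) :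
    (∫ x, fderiv ℝ g x x ∂μ = L (∫ x, fderiv ℝ f x x ∂μ)) ∧
    (∫ x, (fderiv ℝ g x b + ∫ u, truncatedIncrement g x u ∂ν) ∂μ
      = L (∫ x, (fderiv ℝ f x b + ∫ u, truncatedIncrement f x u ∂ν) ∂μ)) := by
  have := hν.sigmaFinite
  have hd := fderiv_apply_eq_clm L hgf
  have ht := truncatedIncrement_eq_clm L hgf
  have hint := integrable_truncatedIncrement (μ := μ) hν f
  have hcont' := continuous_fderiv_schwartz f
  have hslice : ∀ x, Integrable (fun u => truncatedIncrement f x u) ν := fun x => by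
    simpa using integrable_truncatedIncrement (μ := Measure.dirac x) hν f |>.prod_right_ae
  constructor
  · simp_rw [hd]
    obtain ⟨C, -, hC⟩ := exists_norm_fderiv_apply_self_le f
    exact L.integral_comp_comm (Integrable.of_bound (Continuous.aestronglyMeasurable
      (by fun_prop)) C (Eventually.of_forall hC))
  · have hI : Integrable (fun x => fderiv ℝ f x b + ∫ u, truncatedIncrement f x u ∂ν) μ :=
      (integrable_fderiv_apply f b).add hint.integral_prod_left
    rw [← L.integral_comp_comm hI]
    congr 1 with x
    rw [hd, map_add, ← L.integral_comp_comm (hslice x)]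
    simp_rw [ht]

lemma steinIdentity_complex_iff_real [IsProbabilityMeasure μ] (hν : IsLevyMeasure ν) :
    (∀ f : SchwartzMap (EuclideanSpace ℝ (Fin d)) ℂ, SteinIdentity μ ν b f)
      ↔ ∀ f : SchwartzMap (EuclideanSpace ℝ (Fin d)) ℝ, SteinIdentity μ ν b f := by
  constructor
  · intro h g
    obtain ⟨h1, h2⟩ := integral_stein_comp_clm (μ := μ) (b := b) hν Complex.reCLM
      (f := SchwartzMap.postcompCLM Complex.ofRealCLM g) (g := g)
      (fun x => by simp)
    rw [SteinIdentity, h1, h2, h]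
  · intro h f
    have key : ∀ L : ℂ →L[ℝ] ℝ, L (∫ x, fderiv ℝ f x x ∂μ)
        = L (∫ x, (fderiv ℝ f x b + ∫ u, truncatedIncrement f x u ∂ν) ∂μ) := fun L => by
      obtain ⟨h1, h2⟩ := integral_stein_comp_clm (μ := μ) (b := b) hν L
        (f := f) (g := SchwartzMap.postcompCLM L f) (fun x => rfl)
      rw [← h1, ← h2, h]
    exact Complex.ext (key Complex.reCLM) (key Complex.imCLM)

lemma steinIdentity_real_iff [IsProbabilityMeasure μ] (hν : IsLevyMeasure ν)
    (f : SchwartzMap (EuclideanSpace ℝ (Fin d)) ℝ) :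
    SteinIdentity μ ν b f ↔
      ∫ x, ⟪x, gradient (⇑f) x⟫ ∂μ
          = ⟪b, ∫ x, gradient (⇑f) x ∂μ⟫
            + ∫ x, ∫ u, (f (x + u) - f x
                - (if ‖u‖ ≤ 1 then ⟪gradient (⇑f) x, u⟫ else 0)) ∂ν ∂μ := by
  have := hν.sigmaFinite
  have hgrad : Integrable (fun x => gradient (⇑f) x) μ := by
    obtain ⟨C, hC⟩ := exists_norm_fderiv_le f
    refine Integrable.of_bound (Continuous.aestronglyMeasurable ?_) C
      (Eventually.of_forall fun x => ?_)
    · exact (InnerProductSpace.toDual ℝ _).symm.continuous.comp (continuous_fderiv_schwartz f)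
    · rw [gradient, LinearIsometryEquiv.norm_map]
      exact hC x
  have hint : Integrable (fun x => ∫ u, truncatedIncrement f x u ∂ν) μ := by
    have h := Complex.reCLM.integrable_comp (integrable_truncatedIncrement (μ := μ) hν
      (SchwartzMap.postcompCLM Complex.ofRealCLM f))
    simp_rw [← truncatedIncrement_eq_clm Complex.reCLM
      (f := SchwartzMap.postcompCLM Complex.ofRealCLM f) (g := f) (fun x => by simp)] at h
    exact h.integral_prod_left
  have hl : ∀ x v, (⟪gradient (⇑f) x, v⟫ : ℝ) = fderiv ℝ f x v := fun x v => by
    simp [gradient]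
  have hr : ∀ x v, (⟪v, gradient (⇑f) x⟫ : ℝ) = fderiv ℝ f x v := fun x v => by
    rw [real_inner_comm, hl]
  rw [← integral_inner hgrad]
  simp_rw [hl, hr]
  rw [SteinIdentity, integral_add (integrable_fderiv_apply f b) hint]
  rfl

end RealComplex


/-- Characterization of `1`-stable (Cauchy-type) random vectors via a Stein-type identity
(`thm:caracSteinStable3`).  The spherical part `σ` of `ν` is assumed to be centered, which is
expressed by the vanishing of `∫_{‖u‖ ≥ 1} u/‖u‖ ν(du)`. -/
theorem stmt2 {d : ℕ} (μ ν : Measure (EuclideanSpace ℝ (Fin d)))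
    [IsProbabilityMeasure μ] (b : EuclideanSpace ℝ (Fin d))
    (hLevy : IsLevyMeasure ν)
    (hscal : ∀ c : ℝ, 0 < c → ∀ B : Set (EuclideanSpace ℝ (Fin d)), MeasurableSet B →
      ν (c • B) = ENNReal.ofReal c⁻¹ * ν B)
    (hsym : (∫ u in {u : EuclideanSpace ℝ (Fin d) | 1 ≤ ‖u‖}, ‖u‖⁻¹ • u ∂ν) = 0) :
    (∀ f : SchwartzMap (EuclideanSpace ℝ (Fin d)) ℝ,
        ∫ x, ⟪x, gradient (⇑f) x⟫ ∂μ
          = ⟪b, ∫ x, gradient (⇑f) x ∂μ⟫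
            + ∫ x, ∫ u, (f (x + u) - f x
                - (if ‖u‖ ≤ 1 then ⟪gradient (⇑f) x, u⟫ else 0)) ∂ν ∂μ)
      ↔ (∀ ξ, charFn μ ξ
          = Complex.exp (Complex.I * ((⟪b, ξ⟫ : ℝ) : ℂ)
              + ∫ u, (Complex.exp (Complex.I * ((⟪ξ, u⟫ : ℝ) : ℂ)) - 1
                  - (if ‖u‖ ≤ 1 then Complex.I * ((⟪ξ, u⟫ : ℝ) : ℂ) else 0)) ∂ν)) := by
  have hψ := fun (c : ℝ) (hc : 0 < c) ξ => levyExponent_smul (b := b) hLevy hscal hsym hc ξ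
  refine (forall_congr' fun f => (steinIdentity_real_iff hLevy f).symm).trans
    ((steinIdentity_complex_iff_real hLevy).symm.trans
      (Iff.trans ⟨fun h ξ => ?_, fun h f => ?_⟩ (Iff.rfl :
        (∀ ξ, charFn μ ξ = Complex.exp (levyExponent ν b ξ)) ↔ _)))
  · exact charFn_eq_exp_of_steinIdentity hLevy hψ h ξ
  · exact steinIdentity_of_charFn_eq_exp hLevy hψ h f
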